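/- arXiv:math/0611092 — 4 statements merged into one kernel-verified Lean document; each statement's English description precedes it below -/
import Mathlib

section
/- Let n ≥ 1 and let A be a real n×n matrix. For any complex number λ, λ is an eigenvalue of B(A) (i.e., λ lies in the spectrum of B(A) viewed as a complex matrix) if and only if −λ(λ+1) is an eigenvalue of AᵀA. (Equivalently, the spectrum of B(A) is the set of all ½(−1 ± √(1 − s²)) where s ranges over the singular values of A.) -/
open Matrix

/-- The block matrix `B(A) = [[0, Aᵀ], [-A, -I]]`. -/
def Bmat {n : ℕ} (A : Matrix (Fin n) (Fin n) ℝ) :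
    Matrix (Fin n ⊕ Fin n) (Fin n ⊕ Fin n) ℝ :=
  Matrix.fromBlocks 0 Aᵀ (-A) (-1)

/-- The determinant of a block matrix whose diagonal blocks are scalar, not both zero. -/
theorem det_fromBlocks_smul_one {m K : Type*} [Fintype m] [DecidableEq m] [Field K]
    {a d : K} (h : a ≠ 0 ∨ d ≠ 0) (B C : Matrix m m K) :
    (Matrix.fromBlocks (a • 1) B C (d • 1)).det = ((a * d) • 1 - B * C).det := by
  rcases h with ha | hd
  · have key : Matrix.fromBlocks (a • 1) B C (d • 1) * Matrix.fromBlocks 1 (-B) 0 (a • 1) =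
        Matrix.fromBlocks (a • 1) 0 C ((a * d) • 1 - C * B) := by
      simp [Matrix.fromBlocks_multiply, smul_smul, sub_eq_neg_add]
    have comm : ((a * d) • 1 - C * B).det = ((a * d) • 1 - B * C).det := by
      have := congrArg (Polynomial.eval (a * d)) (Matrix.charpoly_mul_comm C B)
      simpa only [Matrix.eval_charpoly, Matrix.scalar_apply, ← Matrix.smul_one_eq_diagonal]
        using this
    have hdet := congrArg Matrix.det key
    rw [Matrix.det_mul, Matrix.det_fromBlocks_zero₂₁, Matrix.det_fromBlocks_zero₁₂,
      Matrix.det_one, one_mul, mul_comm, comm] at hdet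
    exact mul_left_cancel₀ (by simp [ha]) hdet
  · have key : Matrix.fromBlocks (a • 1) B C (d • 1) * Matrix.fromBlocks (d • 1) 0 (-C) 1 =
        Matrix.fromBlocks ((a * d) • 1 - B * C) B 0 (d • 1) := by
      simp [Matrix.fromBlocks_multiply, smul_smul, mul_comm, sub_eq_add_neg]
    have hdet := congrArg Matrix.det key
    rw [Matrix.det_mul, Matrix.det_fromBlocks_zero₂₁, Matrix.det_fromBlocks_zero₁₂,
      Matrix.det_one, mul_one] at hdet
    exact mul_right_cancel₀ (by simp [hd]) hdet

/-- `λ` is an eigenvalue of `B(A)` (viewed as a complex matrix) if and only if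
`-λ(λ+1)` is an eigenvalue of `AᵀA`. -/
theorem eigenvalue_Bmat_iff (n : ℕ) (hn : 1 ≤ n) (A : Matrix (Fin n) (Fin n) ℝ) (lam : ℂ) :
    lam ∈ spectrum ℂ ((Bmat A).map Complex.ofReal) ↔
      (-lam * (lam + 1)) ∈ spectrum ℂ ((Aᵀ * A).map Complex.ofReal) := by
  have hblock : algebraMap ℂ (Matrix (Fin n ⊕ Fin n) (Fin n ⊕ Fin n) ℂ) lam -
      (Bmat A).map Complex.ofReal =
      Matrix.fromBlocks (lam • 1) (-Aᵀ.map Complex.ofReal) (A.map Complex.ofReal)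
        ((lam + 1) • 1) := by
    have hB : (Bmat A).map Complex.ofReal = Matrix.fromBlocks 0 (Aᵀ.map Complex.ofReal)
        (-A.map Complex.ofReal) (-1) := by
      rw [Bmat, Matrix.fromBlocks_map]
      congr 1 <;> ext i j <;> simp [Matrix.one_apply, apply_ite Complex.ofReal]
    rw [hB, Algebra.algebraMap_eq_smul_one, ← Matrix.fromBlocks_one, Matrix.fromBlocks_smul,
      sub_eq_add_neg, Matrix.fromBlocks_neg, Matrix.fromBlocks_add]
    simp [add_smul]
  have hne : lam ≠ 0 ∨ lam + 1 ≠ 0 := by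
    by_contra! h
    simp [h.1] at h
  have hmap : (Aᵀ * A).map Complex.ofReal =
      Aᵀ.map Complex.ofReal * A.map Complex.ofReal :=
    Matrix.map_mul (f := Complex.ofRealHom)
  have hneg : algebraMap ℂ (Matrix (Fin n) (Fin n) ℂ) (-lam * (lam + 1)) -
      Aᵀ.map Complex.ofReal * A.map Complex.ofReal =
      -((lam * (lam + 1)) • 1 - -Aᵀ.map Complex.ofReal * A.map Complex.ofReal) := by
    rw [Algebra.algebraMap_eq_smul_one, neg_mul, neg_smul, neg_mul]
    abel
  rw [spectrum.mem_iff, spectrum.mem_iff, hblock, hmap, hneg, IsUnit.neg_iff,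
    Matrix.isUnit_iff_isUnit_det, Matrix.isUnit_iff_isUnit_det, det_fromBlocks_smul_one hne]
end

section
/- Let n ≥ 1 and let A be a real n×n matrix. The matrix B(A) is Hurwitz stable if and only if A is invertible. -/
open Matrix

/-- A real square matrix is Hurwitz stable if every eigenvalue (over `ℂ`)
has negative real part. -/
def IsHurwitz {m : Type*} [Fintype m] [DecidableEq m] (C : Matrix m m ℝ) : Prop :=
  ∀ lam ∈ spectrum ℂ (C.map Complex.ofReal), lam.re < 0

/-- Over a field, the spectrum of a square matrix consists of its eigenvalues. -/
theorem mem_spectrum_iff_exists_mulVec_eq_smul {K m : Type*} [Field K] [Fintype m]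
    [DecidableEq m] (M : Matrix m m K) (r : K) :
    r ∈ spectrum K M ↔ ∃ v ≠ 0, M *ᵥ v = r • v := by
  rw [spectrum.mem_iff, Matrix.isUnit_iff_isUnit_det, isUnit_iff_ne_zero, not_not,
    ← Matrix.exists_mulVec_eq_zero_iff]
  refine exists_congr fun v => and_congr_right fun _ => ?_
  rw [Algebra.algebraMap_eq_smul_one, Matrix.sub_mulVec, Matrix.smul_mulVec,
    Matrix.one_mulVec, sub_eq_zero, eq_comm]

theorem Bmat_map_ofReal {n : ℕ} (A : Matrix (Fin n) (Fin n) ℝ) :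
    (Bmat A).map Complex.ofReal =
      Matrix.fromBlocks 0 (A.map Complex.ofReal)ᴴ (-A.map Complex.ofReal) (-1) := by
  ext (i | i) (j | j) <;> simp [Bmat, Matrix.one_apply, apply_ite Complex.ofReal]

/-- `B(A)` acts on a pair `(x, y)` as multiplication by `r` iff `Aᴴ y = r x` and
`-(A x) - y = r y`. -/
theorem fromBlocks_mulVec_elim_eq_smul_iff {m : Type*} [Fintype m] [DecidableEq m]
    (M : Matrix m m ℂ) (x y : m → ℂ) (r : ℂ) :
    Matrix.fromBlocks 0 Mᴴ (-M) (-1) *ᵥ Sum.elim x y = r • Sum.elim x y ↔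
      Mᴴ *ᵥ y = r • x ∧ -(M *ᵥ x) - y = r • y := by
  have hr : r • Sum.elim x y = Sum.elim (r • x) (r • y) := by
    ext (i | i) <;> rfl
  rw [Matrix.fromBlocks_mulVec, hr, Sum.elim_eq_iff]
  simp [Matrix.neg_mulVec, sub_eq_add_neg]

open scoped ComplexOrder

/-- The energy identity `Re r * (|x|² + |y|²) = -|y|²`. -/
theorem re_mul_dotProduct_add_eq_neg {m : Type*} [Fintype m]
    (M : Matrix m m ℂ) (x y : m → ℂ) (r : ℂ)
    (hx : Mᴴ *ᵥ y = r • x) (hy : -(M *ᵥ x) - y = r • y) :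
    r.re * ((star x ⬝ᵥ x).re + (star y ⬝ᵥ y).re) = -(star y ⬝ᵥ y).re := by
  have hX : 0 ≤ star x ⬝ᵥ x := dotProduct_star_self_nonneg x
  have hY : 0 ≤ star y ⬝ᵥ y := dotProduct_star_self_nonneg y
  have hcross : star y ⬝ᵥ (M *ᵥ x) = star r * (star x ⬝ᵥ x) := by
    rw [Matrix.dotProduct_mulVec, ← Matrix.conjTranspose_conjTranspose M,
      ← Matrix.star_mulVec, hx, star_smul, smul_dotProduct, smul_eq_mul]
  have key := congrArg (fun v => (star y ⬝ᵥ v).re) hy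
  simp only [dotProduct_sub, dotProduct_neg, dotProduct_smul, smul_eq_mul, hcross] at key
  have hX' := (Complex.nonneg_iff.mp hX).2
  have hY' := (Complex.nonneg_iff.mp hY).2
  simp [Complex.mul_re, ← hX', ← hY'] at key
  linarith

/-- `B(A)` is Hurwitz stable if and only if `A` is invertible. -/
theorem Bmat_isHurwitz_iff_isUnit (n : ℕ) (hn : 1 ≤ n) (A : Matrix (Fin n) (Fin n) ℝ) :
    IsHurwitz (Bmat A) ↔ IsUnit A := by
  rw [IsHurwitz, Bmat_map_ofReal]
  have hdet : IsUnit A ↔ (A.map Complex.ofReal).det ≠ 0 := by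
    have h : (A.map Complex.ofReal).det = (A.det : ℂ) :=
      (RingHom.map_det Complex.ofRealHom A).symm
    rw [Matrix.isUnit_iff_isUnit_det, isUnit_iff_ne_zero, h, Complex.ofReal_ne_zero]
  rw [hdet]
  constructor
  · intro h h0
    obtain ⟨v, hv, hMv⟩ := Matrix.exists_mulVec_eq_zero_iff.mpr h0
    refine lt_irrefl (0 : ℝ) (h 0 ?_)
    rw [mem_spectrum_iff_exists_mulVec_eq_smul]
    refine ⟨Sum.elim v 0, fun h' => hv ?_, ?_⟩
    · exact funext fun i => congrFun h' (Sum.inl i)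
    · rw [fromBlocks_mulVec_elim_eq_smul_iff]
      simp [hMv]
  · intro h r hr
    obtain ⟨v, hv, hMv⟩ := (mem_spectrum_iff_exists_mulVec_eq_smul _ r).mp hr
    obtain ⟨x, y, rfl⟩ : ∃ x y, v = Sum.elim x y :=
      ⟨v ∘ Sum.inl, v ∘ Sum.inr, (Sum.elim_comp_inl_inr v).symm⟩
    obtain ⟨hx, hy⟩ := (fromBlocks_mulVec_elim_eq_smul_iff _ x y r).mp hMv
    have hy0 : y ≠ 0 := by
      rintro rfl
      have hx0 : x = 0 := Matrix.eq_zero_of_mulVec_eq_zero h (by simpa using hy)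
      exact hv (by rw [hx0, Sum.elim_zero_zero])
    have hX := (Complex.nonneg_iff.mp (dotProduct_star_self_nonneg x)).1
    have hY := (Complex.pos_iff.mp (dotProduct_star_self_pos_iff.mpr hy0)).1
    have key := re_mul_dotProduct_add_eq_neg _ x y r hx hy
    by_contra! hre
    nlinarith [mul_nonneg hre (add_nonneg hX hY.le)]
end

section
/- Let n ≥ 2, let M be a real n×n matrix, and suppose there is an integer ω with 1 ≤ ω ≤ n such that sup_{p ∈ S_n} pᵀMp = 1 − 1/ω. Let c be a real number with 0 < c ≤ 1/(n²+1). Then ω is the largest integer k with 1 ≤ k ≤ n satisfying 1 − 1/k ≤ sup_{p ∈ S_n} pᵀ(M + cI)p. -/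
open Matrix

/-- The values of a quadratic form on the standard simplex are bounded above. -/
theorem bddAbove_quadraticForm_stdSimplex {ι : Type*} [Fintype ι] (A : Matrix ι ι ℝ) :
    BddAbove {r : ℝ | ∃ p ∈ stdSimplex ℝ ι, r = p ⬝ᵥ A.mulVec p} := by
  have hcont : Continuous fun p : ι → ℝ => p ⬝ᵥ A.mulVec p := by fun_prop
  refine ((isCompact_stdSimplex ℝ ι).image hcont).bddAbove.mono ?_
  rintro r ⟨p, hp, rfl⟩
  exact ⟨p, hp, rfl⟩

/-- A point of the standard simplex has squared Euclidean norm at most one. -/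
theorem dotProduct_self_le_one_of_mem_stdSimplex {ι : Type*} [Fintype ι] {p : ι → ℝ}
    (hp : p ∈ stdSimplex ℝ ι) : p ⬝ᵥ p ≤ 1 := by
  rw [← hp.2]
  refine Finset.sum_le_sum fun i _ => mul_le_of_le_one_left (hp.1 i) ?_
  rw [← hp.2]
  exact Finset.single_le_sum (fun j _ => hp.1 j) (Finset.mem_univ i)

theorem dotProduct_add_smul_one_mulVec {ι : Type*} [Fintype ι] [DecidableEq ι]
    (A : Matrix ι ι ℝ) (c : ℝ) (p : ι → ℝ) :
    p ⬝ᵥ (A + c • (1 : Matrix ι ι ℝ)).mulVec p = p ⬝ᵥ A.mulVec p + c * (p ⬝ᵥ p) := by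
  rw [add_mulVec, smul_mulVec, one_mulVec, dotProduct_add, dotProduct_smul, smul_eq_mul]

/-- Suppose `sup_{p ∈ Sₙ} pᵀMp = 1 - 1/ω` for an integer `1 ≤ ω ≤ n` (`n ≥ 2`), and
`0 < c ≤ 1/(n²+1)`.  Then `ω` is the largest integer `k` with `1 ≤ k ≤ n` such that
`1 - 1/k ≤ sup_{p ∈ Sₙ} pᵀ(M + cI)p`. -/
theorem clique_number_recovered_from_shifted_form (n : ℕ) (hn : 2 ≤ n)
    (M : Matrix (Fin n) (Fin n) ℝ) (ω : ℕ) (hω₁ : 1 ≤ ω) (hω₂ : ω ≤ n)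
    (hsup : sSup {r : ℝ | ∃ p ∈ stdSimplex ℝ (Fin n), r = p ⬝ᵥ M.mulVec p}
      = 1 - 1 / (ω : ℝ))
    (c : ℝ) (hc₀ : 0 < c) (hc₁ : c ≤ 1 / ((n : ℝ) ^ 2 + 1)) :
    IsGreatest {k : ℕ | 1 ≤ k ∧ k ≤ n ∧
      1 - 1 / (k : ℝ) ≤ sSup {r : ℝ | ∃ p ∈ stdSimplex ℝ (Fin n),
        r = p ⬝ᵥ (M + c • (1 : Matrix (Fin n) (Fin n) ℝ)).mulVec p}} ω := by
  obtain ⟨p₀, hp₀⟩ : (stdSimplex ℝ (Fin n)).Nonempty :=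
    ⟨_, single_mem_stdSimplex ℝ (⟨0, by omega⟩ : Fin n)⟩
  refine ⟨⟨hω₁, hω₂, ?_⟩, ?_⟩
  · rw [← hsup]
    refine csSup_le ⟨_, p₀, hp₀, rfl⟩ ?_
    rintro r ⟨p, hp, rfl⟩
    refine le_trans ?_ (le_csSup (bddAbove_quadraticForm_stdSimplex _) ⟨p, hp, rfl⟩)
    rw [dotProduct_add_smul_one_mulVec]
    have : 0 ≤ p ⬝ᵥ p := Finset.sum_nonneg fun i _ => mul_self_nonneg (p i)
    nlinarith
  · rintro k ⟨-, hkn, hk⟩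
    by_contra! hlt
    have hupper : sSup {r : ℝ | ∃ p ∈ stdSimplex ℝ (Fin n),
        r = p ⬝ᵥ (M + c • (1 : Matrix (Fin n) (Fin n) ℝ)).mulVec p} ≤ 1 - 1 / (ω : ℝ) + c := by
      refine csSup_le ⟨_, p₀, hp₀, rfl⟩ ?_
      rintro r ⟨p, hp, rfl⟩
      rw [dotProduct_add_smul_one_mulVec, ← hsup]
      refine add_le_add (le_csSup (bddAbove_quadraticForm_stdSimplex M) ⟨p, hp, rfl⟩) ?_
      exact mul_le_of_le_one_right hc₀.le (dotProduct_self_le_one_of_mem_stdSimplex hp)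
    have hω : (0 : ℝ) < ω := by exact_mod_cast hω₁
    have hωk : (ω : ℝ) + 1 ≤ k := by exact_mod_cast hlt
    have hkn' : (k : ℝ) ≤ n := by exact_mod_cast hkn
    have hgap : 1 / ((n : ℝ) ^ 2 + 1) < 1 / ((ω : ℝ) * (ω + 1)) :=
      one_div_lt_one_div_of_lt (by positivity) (by nlinarith)
    have hsplit : 1 / (ω : ℝ) - 1 / (ω + 1) = 1 / ((ω : ℝ) * (ω + 1)) := by
      field_simp
      ring
    have hmono : 1 / (k : ℝ) ≤ 1 / ((ω : ℝ) + 1) :=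
      one_div_le_one_div_of_le (by positivity) hωk
    linarith
end

section
/- Let n, k ≥ 1 and let A₁, …, A_k be real n×n matrices. Let C : [0,1] → ℝ^{2n×2n} be a measurable matrix-valued function with C(τ) in the convex hull of {B(A₁), …, B(A_k)} for every τ ∈ [0,1], and let x : [0,1] → ℝ^{2n} be a continuous function satisfying the integral equation x(t) = x(0) + ∫₀ᵗ C(τ)x(τ) dτ for all t ∈ [0,1]. If ‖x(t)‖₂ = 1 for all t ∈ [0,1], then the last n coordinates of x(t) vanish for every t ∈ [0,1]. -/
open Matrix MeasureTheory

/-- The Euclidean norm on `ι → ℝ`. -/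
noncomputable def euclNorm {ι : Type*} [Fintype ι] (x : ι → ℝ) : ℝ :=
  Real.sqrt (∑ i, x i ^ 2)

/-- The quadratic form of `B(A)` only sees the last block. -/
theorem dotProduct_Bmat_mulVec {n : ℕ} (A : Matrix (Fin n) (Fin n) ℝ) (v : Fin n ⊕ Fin n → ℝ) :
    v ⬝ᵥ Bmat A *ᵥ v = -∑ j, v (Sum.inr j) ^ 2 := by
  obtain ⟨a, b, rfl⟩ : ∃ a b, v = Sum.elim a b := ⟨_, _, (Sum.elim_comp_inl_inr v).symm⟩
  have h : a ⬝ᵥ Aᵀ *ᵥ b = b ⬝ᵥ A *ᵥ a := by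
    rw [mulVec_transpose, dotProduct_comm, dotProduct_mulVec]
  have hb : b ⬝ᵥ b = ∑ j, b j ^ 2 := by simp [dotProduct, sq]
  simp [Bmat, fromBlocks_mulVec, sumElim_dotProduct_sumElim, neg_mulVec, h, hb]

/-- The identity for the quadratic form of `B(A)` extends to convex hulls. -/
theorem dotProduct_mulVec_of_mem_convexHull {n : ℕ} {ι : Type*} (A : ι → Matrix (Fin n) (Fin n) ℝ)
    {M : Matrix (Fin n ⊕ Fin n) (Fin n ⊕ Fin n) ℝ}
    (hM : M ∈ convexHull ℝ (Set.range fun i => Bmat (A i))) (v : Fin n ⊕ Fin n → ℝ) :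
    v ⬝ᵥ M *ᵥ v = -∑ j, v (Sum.inr j) ^ 2 := by
  have hconv : Convex ℝ {M : Matrix (Fin n ⊕ Fin n) (Fin n ⊕ Fin n) ℝ |
      v ⬝ᵥ M *ᵥ v = -∑ j, v (Sum.inr j) ^ 2} := by
    intro P hP Q hQ a b _ _ hab
    simp only [Set.mem_ofPred_eq] at hP hQ ⊢
    rw [add_mulVec, smul_mulVec, smul_mulVec, dotProduct_add, dotProduct_smul, dotProduct_smul,
      hP, hQ, ← add_smul, hab, one_smul]
  refine convexHull_min ?_ hconv hM
  rintro _ ⟨i, rfl⟩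
  exact dotProduct_Bmat_mulVec (A i) v

/-- A measurable matrix function with values in a compact set, applied to a continuous vector
function, is integrable on a compact interval. -/
theorem integrableOn_mulVec {ι : Type*} [Fintype ι] {a b : ℝ} {C : ℝ → Matrix ι ι ℝ}
    {K : Set (Matrix ι ι ℝ)} (hK : IsCompact K) (hC : ∀ i j, Measurable fun τ => C τ i j)
    (hCK : ∀ τ ∈ Set.Icc a b, C τ ∈ K) {x : ℝ → ι → ℝ} (hx : ContinuousOn x (Set.Icc a b)) :
    IntegrableOn (fun τ => C τ *ᵥ x τ) (Set.Icc a b) := by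
  obtain ⟨R, hR⟩ := (hK.prod (isCompact_Icc.image_of_continuousOn hx)).exists_bound_of_continuousOn
    (f := fun p : Matrix ι ι ℝ × (ι → ℝ) => p.1 *ᵥ p.2)
    (Continuous.matrix_mulVec continuous_fst continuous_snd).continuousOn
  refine IntegrableOn.of_bound measure_Icc_lt_top ?_ R ?_
  · refine (aemeasurable_pi_iff.2 fun i => ?_).aestronglyMeasurable
    refine Finset.aemeasurable_fun_sum _ fun j _ => (hC i j).aemeasurable.mul ?_
    exact ((continuous_apply j).comp_continuousOn hx).aemeasurable measurableSet_Icc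
  · filter_upwards [ae_restrict_mem measurableSet_Icc] with τ hτ
    exact hR (C τ, x τ) ⟨hCK τ hτ, Set.mem_image_of_mem x hτ⟩

/-- If `x : [0,1] → ℝ^{2n}` is a continuous solution of the integral equation
`x(t) = x(0) + ∫₀ᵗ C(τ)x(τ) dτ` with measurable `C(τ)` taking values in the convex hull
of `{B(A₁), …, B(A_k)}`, and `‖x(t)‖₂ = 1` for all `t ∈ [0,1]`, then the last `n`
coordinates of `x(t)` vanish for all `t ∈ [0,1]`. -/
theorem last_coords_vanish_of_unit_norm_solution (n k : ℕ) (hn : 1 ≤ n) (hk : 1 ≤ k)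
    (A : Fin k → Matrix (Fin n) (Fin n) ℝ)
    (C : ℝ → Matrix (Fin n ⊕ Fin n) (Fin n ⊕ Fin n) ℝ)
    (hC_meas : ∀ i j, Measurable fun τ => C τ i j)
    (hC_mem : ∀ τ ∈ Set.Icc (0 : ℝ) 1,
      C τ ∈ convexHull ℝ (Set.range fun i => Bmat (A i)))
    (x : ℝ → (Fin n ⊕ Fin n → ℝ))
    (hx_cont : ContinuousOn x (Set.Icc (0 : ℝ) 1))
    (hx_eq : ∀ t ∈ Set.Icc (0 : ℝ) 1,
      x t = x 0 + ∫ τ in (0 : ℝ)..t, (C τ).mulVec (x τ))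
    (hx_norm : ∀ t ∈ Set.Icc (0 : ℝ) 1, euclNorm (x t) = 1) :
    ∀ t ∈ Set.Icc (0 : ℝ) 1, ∀ j : Fin n, x t (Sum.inr j) = 0 := by
  have hint := integrableOn_mulVec ((Set.finite_range fun i => Bmat (A i)).isCompact_convexHull ℝ)
    hC_meas hC_mem hx_cont
  have hII : IntervalIntegrable (fun τ => C τ *ᵥ x τ) volume 0 1 :=
    (intervalIntegrable_iff_integrableOn_Icc_of_le zero_le_one).2 hint
  have hsq : ∀ t ∈ Set.Icc (0 : ℝ) 1, ∑ i, x t i ^ 2 = 1 := fun t ht =>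
    Real.sqrt_eq_one.1 (hx_norm t ht)
  have hae : ∀ᵐ t, t ∈ Set.Ioo (0 : ℝ) 1 → ∑ j, x t (Sum.inr j) ^ 2 = 0 := by
    filter_upwards [hII.ae_hasDerivAt_integral] with t hderiv ht
    have hIcc : Set.Icc (0 : ℝ) 1 ∈ nhds t := Icc_mem_nhds ht.1 ht.2
    have htI : t ∈ Set.Icc (0 : ℝ) 1 := Set.Ioo_subset_Icc_self ht
    have hx' : HasDerivAt x (C t *ᵥ x t) t := by
      refine ((hderiv (by simpa using htI) 0 (by simp)).const_add (x 0)).congr_of_eventuallyEq ?_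
      filter_upwards [hIcc] with s hs using hx_eq s hs
    have hnorm : HasDerivAt (fun s => ∑ i, x s i ^ 2) (2 * (x t ⬝ᵥ C t *ᵥ x t)) t := by
      refine (HasDerivAt.fun_sum fun i _ => (hasDerivAt_pi.1 hx' i).pow 2).congr_deriv ?_
      simp only [dotProduct, Finset.mul_sum]
      exact Finset.sum_congr rfl fun i _ => by simp [mul_assoc]
    have hconst : HasDerivAt (fun s => ∑ i, x s i ^ 2) 0 t := by
      refine (hasDerivAt_const t (1 : ℝ)).congr_of_eventuallyEq ?_
      filter_upwards [hIcc] with s hs using hsq s hs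
    have h := hnorm.unique hconst
    rw [dotProduct_mulVec_of_mem_convexHull A (hC_mem t htI)] at h
    linarith
  have hcont : ContinuousOn (fun t => ∑ j, x t (Sum.inr j) ^ 2) (Set.Icc (0 : ℝ) 1) :=
    continuousOn_finsetSum _ fun j _ =>
      ((continuous_apply (Sum.inr j)).comp_continuousOn hx_cont).pow 2
  have hzero : Set.EqOn (fun t => ∑ j, x t (Sum.inr j) ^ 2) (fun _ => 0) (Set.Icc (0 : ℝ) 1) := by
    refine Measure.eqOn_Icc_of_ae_eq volume zero_ne_one ?_ hcont continuousOn_const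
    rw [← restrict_Ioo_eq_restrict_Icc]
    exact (ae_restrict_iff' measurableSet_Ioo).2 hae
  intro t ht j
  have h := (Finset.sum_eq_zero_iff_of_nonneg fun j _ => sq_nonneg (x t (Sum.inr j))).1 (hzero ht)
  exact pow_eq_zero_iff two_ne_zero |>.1 (h j (Finset.mem_univ j))
end
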